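/- Let X be a real Hilbert space, φ : X → ℝ a real-valued convex continuous function, and {C_i}_{i=1}^m a family of nonempty, closed and convex subsets of X with nonempty intersection C, satisfying the bounded regularity condition. Set C_min := {x ∈ C : φ(x) ≤ φ(y) for all y ∈ C}. Let C_* ⊆ C_min be nonempty, and let r_0 ∈ (0,1] and L̄ ≥ 1 be such that |φ(x) − φ(y)| ≤ L̄·‖x − y‖ for all x ∈ C_* and all y ∈ X with ‖x − y‖ < r_0. Fix Δ ∈ (0,1/m), an integer q̄ ≥ m, and suppose (Ω_k, w_k) ∈ M_*(Δ, q̄) for all k ≥ 0. Then any sequence {y^k}_{k=0}^∞ generated by the superiorized DSAP algorithm converges in the norm of X to a point y* ∈ C, and exactly one of the following holds: (1) y* ∈ C_min; or (2) y* ∉ C_min and there exist a natural number k_0 and c_0 ∈ (0,1) such that for each x ∈ C_* and each integer k ≥ k_0, ‖y^{k+1} − x‖² ≤ ‖y^k − x‖² − c_0·Σ_{n=1}^{N_k − 1} β_{k,n}. -/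

import Mathlib

open scoped RealInnerProductSpace

/-- The string operator `P[t] := P_{t_q} ∘ ⋯ ∘ P_{t_1}` : the composition of the
projections indexed by the entries of the index vector `t`, applied in order. -/
def stringOp {X : Type*} {m : ℕ} (P : Fin m → X → X) (t : List (Fin m)) (x : X) : X :=
  t.foldl (fun y i => P i y) x

/-- The string-averaging operator `P_{Ω,w}(x) := Σ_{t ∈ Ω} w(t) • P[t](x)`. -/
noncomputable def strAvg {X : Type*} [NormedAddCommGroup X] [InnerProductSpace ℝ X] {m : ℕ}
    (P : Fin m → X → X) (Ω : Finset (List (Fin m))) (w : List (Fin m) → ℝ) (x : X) : X :=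
  ∑ t ∈ Ω, w t • stringOp P t x

/-- The subgradient set `∂φ(z)` of a function `φ` at a point `z`. -/
def subdiff {X : Type*} [NormedAddCommGroup X] [InnerProductSpace ℝ X]
    (φ : X → ℝ) (z : X) : Set X :=
  {s : X | ∀ y : X, φ z + ⟪s, y - z⟫ ≤ φ y}

lemma aux_proj {X : Type*} [NormedAddCommGroup X] [InnerProductSpace ℝ X]
    (K : Set X) (hK : Convex ℝ K) (x p : X) (hp : p ∈ K) (hmin : ∀ c ∈ K, ‖x - p‖ ≤ ‖x - c‖)
    (z : X) (hz : z ∈ K) : ‖p - z‖ ^ 2 + ‖x - p‖ ^ 2 ≤ ‖x - z‖ ^ 2 := by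
  have h1 : ‖x - p‖ = ⨅ w : K, ‖x - w‖ := by
    haveI : Nonempty K := ⟨⟨p, hp⟩⟩
    apply le_antisymm
    · exact le_ciInf fun c => hmin c c.2
    · exact ciInf_le (f := fun w : K => ‖x - w‖) ⟨0, by rintro _ ⟨c, rfl⟩; positivity⟩ ⟨p, hp⟩
  have h2 := (norm_eq_iInf_iff_real_inner_le_zero hK hp).1 h1 z hz
  have h3 : x - z = (x - p) - (z - p) := by abel
  rw [h3, norm_sub_sq_real (x - p) (z - p), norm_sub_rev p z]
  linarith

lemma aux_string {X : Type*} [NormedAddCommGroup X] [InnerProductSpace ℝ X] {m : ℕ}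
    (P : Fin m → X → X) (z : X)
    (hP : ∀ i x, ‖P i x - z‖ ^ 2 + ‖x - P i x‖ ^ 2 ≤ ‖x - z‖ ^ 2) (t : List (Fin m)) :
    ∀ x, ‖stringOp P t x - z‖ ^ 2 ≤ ‖x - z‖ ^ 2 := by
  induction t with
  | nil => intro x; simp [stringOp]
  | cons j t ih =>
    intro x
    have h1 := ih (P j x)
    have h2 := hP j x
    have h3 : stringOp P (j :: t) x = stringOp P t (P j x) := rfl
    rw [h3]
    nlinarith [sq_nonneg ‖x - P j x‖]

lemma aux_dist {X : Type*} [NormedAddCommGroup X] [InnerProductSpace ℝ X] {m : ℕ}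
    (C : Fin m → Set X) (P : Fin m → X → X) (z : X) (hPC : ∀ i x, P i x ∈ C i)
    (hP : ∀ i x, ‖P i x - z‖ ^ 2 + ‖x - P i x‖ ^ 2 ≤ ‖x - z‖ ^ 2) (η : ℝ) (hη : 0 ≤ η)
    (i : Fin m) (t : List (Fin m)) :
    ∀ x, ‖x - z‖ ^ 2 - ‖stringOp P t x - z‖ ^ 2 ≤ η ^ 2 → i ∈ t →
      Metric.infDist x (C i) ≤ t.length * η := by
  induction t with
  | nil => intro x _ h; simp at h
  | cons j t ih =>
    intro x hx hi
    have h3 : stringOp P (j :: t) x = stringOp P t (P j x) := rfl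
    rw [h3] at hx
    have h1 := aux_string P z hP t (P j x)
    have h2 := hP j x
    have h4 : ‖x - P j x‖ ≤ η := by
      apply le_of_sq_le_sq _ hη
      linarith
    have h0 : (0 : ℝ) ≤ t.length * η := by positivity
    have hl : (((j :: t).length : ℕ) : ℝ) * η = t.length * η + η := by
      push_cast [List.length_cons]; ring
    rw [hl]
    rcases List.mem_cons.1 hi with rfl | hi
    · have := Metric.infDist_le_dist_of_mem (x := x) (hPC i x)
      rw [dist_eq_norm] at this
      linarith
    · have h5 := ih (P j x) (by nlinarith [sq_nonneg ‖x - P j x‖]) hi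
      have h6 := Metric.infDist_le_infDist_add_dist (s := C i) (x := x) (y := P j x)
      rw [dist_eq_norm] at h6
      linarith

lemma aux_avg {X : Type*} [NormedAddCommGroup X] [InnerProductSpace ℝ X] {m : ℕ}
    (P : Fin m → X → X) (z : X)
    (hP : ∀ i x, ‖P i x - z‖ ^ 2 + ‖x - P i x‖ ^ 2 ≤ ‖x - z‖ ^ 2)
    (Δ : ℝ) (hΔ : 0 < Δ) (Ω : Finset (List (Fin m))) (w : List (Fin m) → ℝ)
    (hw : ∀ t ∈ Ω, Δ ≤ w t) (hsum : ∑ t ∈ Ω, w t = 1) (x : X) (t : List (Fin m)) (ht : t ∈ Ω) :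
    Δ * (‖x - z‖ ^ 2 - ‖stringOp P t x - z‖ ^ 2) ≤ ‖x - z‖ ^ 2 - ‖strAvg P Ω w x - z‖ ^ 2 := by
  have hcv : ConvexOn ℝ Set.univ (fun u : X => ‖u‖ ^ 2) :=
    (convexOn_univ_norm).pow (fun _ _ => norm_nonneg _) 2
  have h1 : strAvg P Ω w x - z = ∑ t ∈ Ω, w t • (stringOp P t x - z) := by
    simp only [smul_sub, Finset.sum_sub_distrib, ← Finset.sum_smul, hsum, one_smul, strAvg]
  have h2 := hcv.map_sum_le (t := Ω) (w := w) (p := fun t => stringOp P t x - z)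
    (fun t ht => hΔ.le.trans (hw t ht)) hsum (fun _ _ => Set.mem_univ _)
  rw [← h1] at h2
  simp only [smul_eq_mul] at h2
  have h3 : ∑ t ∈ Ω, w t * (‖x - z‖ ^ 2 - ‖stringOp P t x - z‖ ^ 2)
      = ‖x - z‖ ^ 2 - ∑ t ∈ Ω, w t * ‖stringOp P t x - z‖ ^ 2 := by
    simp only [mul_sub, Finset.sum_sub_distrib, ← Finset.sum_mul, hsum, one_mul]
  have hnn : ∀ t, 0 ≤ ‖x - z‖ ^ 2 - ‖stringOp P t x - z‖ ^ 2 := fun t => by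
    have := aux_string P z hP t x; linarith
  have h4 : w t * (‖x - z‖ ^ 2 - ‖stringOp P t x - z‖ ^ 2) ≤
      ∑ t ∈ Ω, w t * (‖x - z‖ ^ 2 - ‖stringOp P t x - z‖ ^ 2) :=
    Finset.single_le_sum (f := fun t => w t * (‖x - z‖ ^ 2 - ‖stringOp P t x - z‖ ^ 2))
      (fun t ht => mul_nonneg (hΔ.le.trans (hw t ht)) (hnn t)) ht
  have h5 := mul_le_mul_of_nonneg_right (hw t ht) (hnn t)
  linarith

lemma aux_conv (a e : ℕ → ℝ) (ha : ∀ k, 0 ≤ a k) (he0 : ∀ k, 0 ≤ e k) (he : Summable e)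
    (h : ∀ k, a (k + 1) ≤ a k + e k) : ∃ l, Filter.Tendsto a Filter.atTop (nhds l) := by
  have hanti : Antitone (fun k => a k - ∑ j ∈ Finset.range k, e j) := by
    apply antitone_nat_of_succ_le
    intro k
    rw [Finset.sum_range_succ]
    linarith [h k]
  have hbdd : BddBelow (Set.range (fun k => a k - ∑ j ∈ Finset.range k, e j)) := by
    refine ⟨-∑' j, e j, ?_⟩
    rintro _ ⟨k, rfl⟩
    have := he.sum_le_tsum (Finset.range k) (fun j _ => he0 j)
    have := ha k
    simp only
    linarith
  have h1 := tendsto_atTop_ciInf hanti hbdd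
  have h2 := h1.add he.hasSum.tendsto_sum_nat
  exact ⟨_, h2.congr (fun k => by ring)⟩

theorem stmt_2
    {X : Type*} [NormedAddCommGroup X] [InnerProductSpace ℝ X] [CompleteSpace X]
    -- a convex continuous objective function
    (φ : X → ℝ) (hφconv : ConvexOn ℝ Set.univ φ) (hφcont : Continuous φ)
    {m : ℕ} (hm : 0 < m) (C : Fin m → Set X)
    (hCne : ∀ i, (C i).Nonempty) (hCcl : ∀ i, IsClosed (C i)) (hCcv : ∀ i, Convex ℝ (C i))
    (hCint : (⋂ i, C i).Nonempty)
    -- bounded regularity condition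
    (hreg : ∀ ε > (0 : ℝ), ∀ M > (0 : ℝ), ∃ δ > (0 : ℝ), ∀ x : X, ‖x‖ < M →
      (∀ i, Metric.infDist x (C i) < δ) → Metric.infDist x (⋂ i, C i) < ε)
    -- the constrained minimizers C_min and the subset C_*
    (Cmin : Set X) (hCmin : Cmin = {x ∈ ⋂ i, C i | ∀ y ∈ ⋂ i, C i, φ x ≤ φ y})
    (Cstar : Set X) (hCstar : Cstar ⊆ Cmin) (hCstarne : Cstar.Nonempty)
    -- local Lipschitz-type condition near C_*
    (r0 : ℝ) (hr0 : r0 ∈ Set.Ioc (0 : ℝ) 1) (L : ℝ) (hL : 1 ≤ L)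
    (hLip : ∀ x ∈ Cstar, ∀ y : X, ‖x - y‖ < r0 → |φ x - φ y| ≤ L * ‖x - y‖)
    -- `P i` is the metric projection onto `C i`
    (P : Fin m → X → X)
    (hP : ∀ i x, P i x ∈ C i ∧ ∀ c ∈ C i, ‖x - P i x‖ ≤ ‖x - c‖)
    -- parameters of the class `M_*(Δ, q̄)`
    (Δ : ℝ) (hΔ0 : 0 < Δ) (hΔm : Δ < 1 / (m : ℝ)) (qbar : ℕ) (hqbar : m ≤ qbar)
    -- the pairs (Ω_k, w_k) ∈ M_*(Δ, q̄)
    (Ω : ℕ → Finset (List (Fin m))) (w : ℕ → List (Fin m) → ℝ)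
    (hΩne : ∀ k, ∀ t ∈ Ω k, t ≠ [])
    (hfit : ∀ k, ∀ i : Fin m, ∃ t ∈ Ω k, i ∈ t)
    (hlen : ∀ k, ∀ t ∈ Ω k, t.length ≤ qbar)
    (hwΔ : ∀ k, ∀ t ∈ Ω k, Δ ≤ w k t)
    (hwsum : ∀ k, ∑ t ∈ Ω k, w k t = 1)
    -- the superiorized version of the DSAP algorithm
    (N : ℕ) (Nk : ℕ → ℕ) (hNk : ∀ k, 1 ≤ Nk k ∧ Nk k ≤ N)
    (β : ℕ → ℕ → ℝ) (hβ : ∀ k, ∀ n < Nk k, 0 < β k n ∧ β k n ≤ 1)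
    (hβsum : Summable fun k => ∑ n ∈ Finset.range (Nk k), β k n)
    (y : ℕ → X) (Y : ℕ → ℕ → X) (v : ℕ → ℕ → X) (s : ℕ → ℕ → X)
    (hY0 : ∀ k, Y k 0 = y k)
    (hs : ∀ k, ∀ n < Nk k, s k n ∈ subdiff φ (Y k n))
    (hv : ∀ k, ∀ n < Nk k,
      ((0 : X) ∉ subdiff φ (Y k n) → v k n = -(‖s k n‖⁻¹ • s k n)) ∧
      ((0 : X) ∈ subdiff φ (Y k n) → v k n = 0))
    (hYn : ∀ k, ∀ n < Nk k, Y k (n + 1) = Y k n + β k n • v k n)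
    (hy : ∀ k, y (k + 1) = strAvg P (Ω k) (w k) (Y k (Nk k))) :
    ∃ ystar ∈ ⋂ i, C i, Filter.Tendsto y Filter.atTop (nhds ystar) ∧
      Xor' (ystar ∈ Cmin)
        (ystar ∉ Cmin ∧ ∃ k0 : ℕ, ∃ c0 ∈ Set.Ioo (0 : ℝ) 1, ∀ x ∈ Cstar, ∀ k ≥ k0,
          ‖y (k + 1) - x‖ ^ 2 ≤ ‖y k - x‖ ^ 2 - c0 * ∑ n ∈ Finset.Ico 1 (Nk k), β k n) := by
  classical
  have hPC : ∀ i x, P i x ∈ C i := fun i x => (hP i x).1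
  have hPz : ∀ z ∈ ⋂ i, C i, ∀ i x, ‖P i x - z‖ ^ 2 + ‖x - P i x‖ ^ 2 ≤ ‖x - z‖ ^ 2 :=
    fun z hz i x => aux_proj (C i) (hCcv i) x (P i x) (hP i x).1 (hP i x).2 z
      (Set.mem_iInter.1 hz i)
  set e : ℕ → ℝ := fun k => ∑ n ∈ Finset.range (Nk k), β k n with he
  have he0 : ∀ k, 0 ≤ e k := fun k =>
    Finset.sum_nonneg fun n hn => (hβ k n (Finset.mem_range.1 hn)).1.le
  have hvn : ∀ k, ∀ n < Nk k, ‖v k n‖ ≤ 1 := by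
    intro k n hn
    by_cases h : (0 : X) ∈ subdiff φ (Y k n)
    · rw [(hv k n hn).2 h]; simp
    · rw [(hv k n hn).1 h, norm_neg, norm_smul, norm_inv, norm_norm]
      exact inv_mul_le_one
  have hYd' : ∀ k, ∀ n ≤ Nk k, ‖Y k n - y k‖ ≤ ∑ j ∈ Finset.range n, β k j := by
    intro k n
    induction n with
    | zero => intro _; simp [hY0]
    | succ n ih =>
      intro hn
      have h1 := ih (by omega)
      have hb := hβ k n (by omega)
      rw [hYn k n (by omega), Finset.sum_range_succ]
      have h2 : Y k n + β k n • v k n - y k = (Y k n - y k) + β k n • v k n := by abel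
      rw [h2]
      refine (norm_add_le _ _).trans (add_le_add h1 ?_)
      rw [norm_smul, Real.norm_of_nonneg hb.1.le]
      have := hvn k n (by omega)
      nlinarith
  have hYd : ∀ k, ∀ n ≤ Nk k, ‖Y k n - y k‖ ≤ e k := by
    intro k n hn
    refine (hYd' k n hn).trans ?_
    apply Finset.sum_le_sum_of_subset_of_nonneg
    · intro j hj; simp only [Finset.mem_range] at *; omega
    · intro j hj _; exact (hβ k j (Finset.mem_range.1 hj)).1.le
  set u : ℕ → X := fun k => Y k (Nk k) with hu
  have hTsq : ∀ z ∈ ⋂ i, C i, ∀ k, ∀ t ∈ Ω k,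
      Δ * (‖u k - z‖ ^ 2 - ‖stringOp P t (u k) - z‖ ^ 2) ≤ ‖u k - z‖ ^ 2 - ‖y (k + 1) - z‖ ^ 2 := by
    intro z hz k t ht
    rw [hy k]
    exact aux_avg P z (hPz z hz) Δ hΔ0 (Ω k) (w k) (hwΔ k) (hwsum k) (u k) t ht
  have hTle : ∀ z ∈ ⋂ i, C i, ∀ k, ‖y (k + 1) - z‖ ^ 2 ≤ ‖u k - z‖ ^ 2 := by
    intro z hz k
    obtain ⟨t, ht, -⟩ := hfit k ⟨0, hm⟩
    have h1 := hTsq z hz k t ht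
    have h2 := aux_string P z (hPz z hz) t (u k)
    have := mul_nonneg hΔ0.le (sub_nonneg.2 h2)
    linarith
  have hTle' : ∀ z ∈ ⋂ i, C i, ∀ k, ‖y (k + 1) - z‖ ≤ ‖u k - z‖ := fun z hz k =>
    le_of_sq_le_sq (hTle z hz k) (norm_nonneg _)
  have hule : ∀ z k, ‖u k - z‖ ≤ ‖y k - z‖ + e k := by
    intro z k
    have h1 := hYd k (Nk k) le_rfl
    have h2 : u k - z = (y k - z) + (Y k (Nk k) - y k) := by simp only [hu]; abel
    rw [h2]
    exact (norm_add_le _ _).trans (by linarith)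
  have hstep : ∀ z ∈ ⋂ i, C i, ∀ k, ‖y (k + 1) - z‖ ≤ ‖y k - z‖ + e k := fun z hz k =>
    (hTle' z hz k).trans (hule z k)
  have helim : Filter.Tendsto e Filter.atTop (nhds 0) := hβsum.tendsto_atTop_zero
  obtain ⟨z, hz⟩ := hCint
  obtain ⟨l, hl⟩ := aux_conv (fun k => ‖y k - z‖) e (fun _ => norm_nonneg _) he0 hβsum (hstep z hz)
  have hl1 : Filter.Tendsto (fun k => ‖y (k + 1) - z‖) Filter.atTop (nhds l) :=
    hl.comp (Filter.tendsto_add_atTop_nat 1)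
  have hul : Filter.Tendsto (fun k => ‖u k - z‖) Filter.atTop (nhds l) := by
    refine tendsto_of_tendsto_of_tendsto_of_le_of_le hl1 ?_ (hTle' z hz) (hule z)
    simpa using hl.add helim
  have hD : Filter.Tendsto (fun k => ‖u k - z‖ ^ 2 - ‖y (k + 1) - z‖ ^ 2) Filter.atTop (nhds 0) := by
    simpa using (hul.pow 2).sub (hl1.pow 2)
  -- distances to the individual sets
  have hdist : ∀ δ > (0 : ℝ), ∀ᶠ k in Filter.atTop, ∀ i, Metric.infDist (u k) (C i) < δ := by
    intro δ hδ
    set η : ℝ := δ / (qbar + 1) with hη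
    have hη0 : 0 < η := by positivity
    filter_upwards [hD.eventually_lt_const (show (0 : ℝ) < Δ * η ^ 2 by positivity)] with k hk i
    obtain ⟨t, ht, hit⟩ := hfit k i
    have h1 := hTsq z hz k t ht
    have h2 : ‖u k - z‖ ^ 2 - ‖stringOp P t (u k) - z‖ ^ 2 ≤ η ^ 2 :=
      le_of_mul_le_mul_left (h1.trans hk.le) hΔ0
    have h3 := aux_dist C P z hPC (hPz z hz) η hη0.le i t (u k) h2 hit
    have h4 : (t.length : ℝ) ≤ qbar := by exact_mod_cast hlen k t ht
    have h5 : (qbar + 1) * η = δ := by rw [hη]; field_simp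
    nlinarith
  have hdistC : ∀ ε > (0 : ℝ), ∀ᶠ k in Filter.atTop, Metric.infDist (u k) (⋂ i, C i) < ε := by
    intro ε hε
    obtain ⟨δ, hδ, hδ'⟩ := hreg ε hε (|l| + 1 + ‖z‖) (by positivity)
    filter_upwards [hdist δ hδ, hul.eventually_lt_const (show l < |l| + 1 by
      linarith [le_abs_self l])] with k hk hk2
    refine hδ' _ ?_ hk
    have : u k = (u k - z) + z := by abel
    rw [this]
    exact (norm_add_le _ _).trans_lt (by linarith)
  have hClosed : IsClosed (⋂ i, C i) := isClosed_iInter hCcl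
  -- tail estimate
  have htail : ∀ c ∈ ⋂ i, C i, ∀ k j, ‖y (k + j) - c‖ ≤ ‖y k - c‖ + ∑ n ∈ Finset.range j, e (n + k) := by
    intro c hc k j
    induction j with
    | zero => simp
    | succ j ih =>
      have := hstep c hc (k + j)
      rw [Finset.sum_range_succ, add_comm j k, ← add_assoc]
      linarith
  have hcauchy : CauchySeq y := by
    rw [Metric.cauchySeq_iff']
    intro ε hε
    have ht0 := tendsto_sum_nat_add e
    obtain ⟨k, hk1, hk2, hk3⟩ := ((hdistC (ε / 8) (by positivity)).and
      ((ht0.eventually_lt_const (show (0 : ℝ) < ε / 8 by positivity)).and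
        (helim.eventually_lt_const (show (0 : ℝ) < ε / 8 by positivity)))).exists
    obtain ⟨c, hc, hc'⟩ := (Metric.infDist_lt_iff ⟨z, hz⟩).1 hk1
    rw [dist_eq_norm] at hc'
    have h1 : ‖y k - c‖ < ε / 4 := by
      have h2 := hYd k (Nk k) le_rfl
      have h3 : y k - c = (u k - c) - (Y k (Nk k) - y k) := by simp only [hu]; abel
      rw [h3]
      exact (norm_sub_le _ _).trans_lt (by linarith)
    refine ⟨k, fun n hn => ?_⟩
    obtain ⟨j, rfl⟩ := Nat.exists_eq_add_of_le hn
    have h4 := htail c hc k j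
    have h5 : ∑ n ∈ Finset.range j, e (n + k) ≤ ∑' n, e (n + k) :=
      ((summable_nat_add_iff k).2 hβsum).sum_le_tsum _ (fun n _ => he0 _)
    rw [dist_eq_norm]
    have h6 : y (k + j) - y k = (y (k + j) - c) - (y k - c) := by abel
    rw [h6]
    exact (norm_sub_le _ _).trans_lt (by linarith)
  obtain ⟨ys, hys⟩ := cauchySeq_tendsto_of_complete hcauchy
  have huy : Filter.Tendsto (fun k => u k - y k) Filter.atTop (nhds 0) :=
    squeeze_zero_norm (fun k => hYd k (Nk k) le_rfl) helim
  have hus : Filter.Tendsto u Filter.atTop (nhds ys) := by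
    simpa using huy.add hys
  have hysC : ys ∈ ⋂ i, C i := by
    rw [hClosed.mem_iff_infDist_zero ⟨z, hz⟩]
    have h1 : Filter.Tendsto (fun k => Metric.infDist (u k) (⋂ i, C i)) Filter.atTop
        (nhds (Metric.infDist ys (⋂ i, C i))) :=
      ((Metric.continuous_infDist_pt _).tendsto ys).comp hus
    apply le_antisymm _ Metric.infDist_nonneg
    apply le_of_forall_pos_le_add
    intro ε hε
    rw [zero_add]
    exact le_of_tendsto h1 ((hdistC ε hε).mono fun _ h => h.le)
  refine ⟨ys, hysC, hys, ?_⟩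
  by_cases hmem : ys ∈ Cmin
  · exact Or.inl ⟨hmem, fun h => h.1 hmem⟩
  refine Or.inr ⟨⟨hmem, ?_⟩, hmem⟩
  obtain ⟨x0, hx0⟩ := hCstarne
  have hminS : ∀ x ∈ Cstar, x ∈ (⋂ i, C i) ∧ ∀ y ∈ ⋂ i, C i, φ x ≤ φ y := by
    intro x hx
    have := hCstar hx
    rw [hCmin] at this
    exact this
  have hval : ∀ x ∈ Cstar, φ x = φ x0 := fun x hx =>
    le_antisymm ((hminS x hx).2 x0 (hminS x0 hx0).1) ((hminS x0 hx0).2 x (hminS x hx).1)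
  have hgt : φ x0 < φ ys := by
    by_contra hcon
    apply hmem
    rw [hCmin]
    exact ⟨hysC, fun c hc => (not_lt.1 hcon).trans ((hminS x0 hx0).2 c hc)⟩
  set η : ℝ := (φ ys - φ x0) / 2 with hη
  have hη0 : 0 < η := by rw [hη]; linarith
  obtain ⟨ρ, hρ, hball⟩ := Metric.mem_nhds_iff.1
    ((hφcont.tendsto ys).eventually_const_lt (show φ x0 + η < φ ys by rw [hη]; linarith))
  set r : ℝ := min (r0 / 2) (η / L) with hr
  have hr0' : 0 < r := lt_min (by linarith [hr0.1]) (by positivity)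
  have hrr : r < r0 := (min_le_left _ _).trans_lt (by linarith [hr0.1])
  have hr1 : r < 1 := hrr.trans_le hr0.2
  have hLr : L * r ≤ η := by
    have : r ≤ η / L := min_le_right _ _
    rw [le_div_iff₀ (by linarith)] at this
    linarith
  have hev : ∀ᶠ k in Filter.atTop, ‖y k - ys‖ < ρ / 2 ∧ e k < ρ / 2 ∧ e k < r := by
    refine Filter.Eventually.and ?_ ((helim.eventually_lt_const (by positivity)).and
      (helim.eventually_lt_const hr0'))
    have := (hys.sub_const ys).norm
    rw [sub_self, norm_zero] at this
    exact this.eventually_lt_const (by positivity)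
  obtain ⟨k0, hk0⟩ := Filter.eventually_atTop.1 hev
  refine ⟨k0, r, ⟨hr0', hr1⟩, ?_⟩
  intro x hx k hk
  obtain ⟨hka, hkb, hkc⟩ := hk0 k hk
  have hin : ∀ n < Nk k, ⟪v k n, Y k n - x⟫ ≤ -r := by
    intro n hn
    have hYball : φ x0 + η < φ (Y k n) := by
      apply hball
      rw [Metric.mem_ball, dist_eq_norm]
      have h1 := hYd k n hn.le
      have h2 : Y k n - ys = (Y k n - y k) + (y k - ys) := by abel
      rw [h2]
      exact (norm_add_le _ _).trans_lt (by linarith)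
    have h0 : (0 : X) ∉ subdiff φ (Y k n) := by
      intro h
      have := h x0
      simp at this
      linarith
    have hsn : s k n ≠ 0 := fun h => h0 (h ▸ hs k n hn)
    have hsn' : 0 < ‖s k n‖ := norm_pos_iff.2 hsn
    have hvne : ‖v k n‖ = 1 := by
      rw [(hv k n hn).1 h0, norm_neg, norm_smul, norm_inv, norm_norm]
      exact inv_mul_cancel₀ hsn'.ne'
    have hsv : s k n = -(‖s k n‖ • v k n) := by
      rw [(hv k n hn).1 h0, smul_neg, neg_neg, smul_smul, mul_inv_cancel₀ hsn'.ne', one_smul]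
    have h1 := hs k n hn (x - r • v k n)
    have hnx : ‖x - (x - r • v k n)‖ = r := by
      rw [sub_sub_cancel, norm_smul, hvne, Real.norm_of_nonneg hr0'.le, mul_one]
    have h2 := hLip x hx (x - r • v k n) (by rw [hnx]; exact hrr)
    rw [hnx, hval x hx] at h2
    have h3 := (abs_le.1 h2).1
    have h4 : ⟪s k n, x - r • v k n - Y k n⟫ < 0 := by linarith
    have h5 : ⟪s k n, x - r • v k n - Y k n⟫ = ‖s k n‖ * (⟪v k n, Y k n - x⟫ + r) := by
      have h6 : x - r • v k n - Y k n = -((Y k n - x) + r • v k n) := by abel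
      rw [h6, inner_neg_right]
      nth_rewrite 1 [hsv]
      rw [inner_neg_left, neg_neg, real_inner_smul_left, inner_add_right, real_inner_smul_right,
        real_inner_self_eq_norm_sq, hvne]
      ring
    rw [h5] at h4
    by_contra hcon
    have := mul_pos hsn' (show 0 < ⟪v k n, Y k n - x⟫ + r by linarith)
    linarith
  have hdec : ∀ n ≤ Nk k, ‖Y k n - x‖ ^ 2 ≤ ‖y k - x‖ ^ 2 - r * ∑ j ∈ Finset.range n, β k j := by
    intro n
    induction n with
    | zero => intro _; simp [hY0]
    | succ n ih =>
      intro hn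
      have hn' : n < Nk k := by omega
      have h1 := ih hn'.le
      have hb := hβ k n hn'
      have hbr : β k n ≤ r := by
        have : β k n ≤ e k := Finset.single_le_sum (f := fun j => β k j)
          (fun j hj => (hβ k j (Finset.mem_range.1 hj)).1.le) (Finset.mem_range.2 hn')
        linarith
      have h2 : Y k n + β k n • v k n - x = (Y k n - x) + β k n • v k n := by abel
      rw [hYn k n hn', h2, norm_add_sq_real, real_inner_smul_right, real_inner_comm,
        Finset.sum_range_succ, norm_smul, Real.norm_of_nonneg hb.1.le]
      have h3 := mul_le_mul_of_nonneg_left (hin n hn') hb.1.le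
      have h4 : (β k n * ‖v k n‖) ^ 2 ≤ β k n * r := by
        have h5 : β k n * ‖v k n‖ ≤ β k n := mul_le_of_le_one_right hb.1.le (hvn k n hn')
        have h6 : 0 ≤ β k n * ‖v k n‖ := mul_nonneg hb.1.le (norm_nonneg _)
        nlinarith
      nlinarith
  have h1 := hdec (Nk k) le_rfl
  have h2 := hTle x (hminS x hx).1 k
  have h3 : ∑ n ∈ Finset.Ico 1 (Nk k), β k n ≤ ∑ n ∈ Finset.range (Nk k), β k n := by
    apply Finset.sum_le_sum_of_subset_of_nonneg
    · intro j hj; simp only [Finset.mem_range, Finset.mem_Ico] at *; omega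
    · intro j hj _; exact (hβ k j (Finset.mem_range.1 hj)).1.le
  have h4 := mul_le_mul_of_nonneg_left h3 hr0'.le
  have h5 : ‖u k - x‖ = ‖Y k (Nk k) - x‖ := rfl
  rw [h5] at h2
  linarith
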